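/- Let x₀, x₁ ∈ ℝⁿ, let α, β : ℝ → ℝ be twice differentiable, and define x(t) = α(t)·x₀ + β(t)·x₁. Fix t ∈ ℝ and suppose the Wronskian W(t) = α(t)·β'(t) − α'(t)·β(t) is nonzero. Then the second derivative of the path is a function of the position and velocity at time t: x''(t) = ((α''(t)·β'(t) − β''(t)·α'(t))/W(t))·x(t) + ((β''(t)·α(t) − α''(t)·β(t))/W(t))·x'(t). -/

import Mathlib

/-- The derivative of the path `s ↦ a s • u + b s • v` with differentiable coefficients. -/
theorem deriv_smul_const_add_smul_const {E : Type*} [NormedAddCommGroup E] [NormedSpace ℝ E]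
    {a b : ℝ → ℝ} (ha : Differentiable ℝ a) (hb : Differentiable ℝ b) (u v : E) :
    deriv (fun s => a s • u + b s • v) = fun s => deriv a s • u + deriv b s • v :=
  funext fun s =>
    (((ha s).hasDerivAt.smul_const u).add ((hb s).hasDerivAt.smul_const v)).deriv

/-- For the interpolation path `x(t) = α(t)·x₀ + β(t)·x₁` with twice differentiable
schedules, if the Wronskian `W(t) = α(t)·β'(t) − α'(t)·β(t)` is nonzero, then the
acceleration is a function of position and velocity:
`x''(t) = ((α''β' − β''α')/W)·x(t) + ((β''α − α''β)/W)·x'(t)`. -/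
theorem second_deriv_from_position_velocity
    (n : ℕ) (x₀ x₁ : EuclideanSpace ℝ (Fin n)) (α β : ℝ → ℝ)
    (hα : Differentiable ℝ α) (hα' : Differentiable ℝ (deriv α))
    (hβ : Differentiable ℝ β) (hβ' : Differentiable ℝ (deriv β))
    (x : ℝ → EuclideanSpace ℝ (Fin n))
    (hx : ∀ s : ℝ, x s = α s • x₀ + β s • x₁)
    (t : ℝ) (hW : α t * deriv β t - deriv α t * β t ≠ 0) :
    deriv (deriv x) t =
      ((deriv (deriv α) t * deriv β t - deriv (deriv β) t * deriv α t) /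
          (α t * deriv β t - deriv α t * β t)) • x t +
        ((deriv (deriv β) t * α t - deriv (deriv α) t * β t) /
          (α t * deriv β t - deriv α t * β t)) • deriv x t := by
  obtain rfl : x = fun s => α s • x₀ + β s • x₁ := funext hx
  rw [deriv_smul_const_add_smul_const hα hβ, deriv_smul_const_add_smul_const hα' hβ']
  generalize hw : α t * deriv β t - deriv α t * β t = w at hW ⊢
  match_scalars <;> field_simp <;> rw [← hw] <;> ring
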